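/- Let 𝒫 be the set of all prime numbers and, for each p ∈ 𝒫, let (ℚ, τ_p) denote the field of rational numbers equipped with the p-adic topology (the topology induced by the p-adic norm). Then the topological product G = ∏_{p ∈ 𝒫} SL(p+1, (ℚ, τ_p)) is minimal. -/

import Mathlib

/-- A Hausdorff topological group `(G, τ)` is *minimal* if every Hausdorff group topology
on `G` coarser than `τ` equals `τ`.  (In Mathlib's order on `TopologicalSpace G`,
"`σ` is coarser than `τ`" is `τ ≤ σ`.) -/
def IsMinimal (G : Type*) [Group G] [τ : TopologicalSpace G] : Prop :=
  ∀ σ : GroupTopology G, τ ≤ σ.toTopologicalSpace →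
    @T2Space G σ.toTopologicalSpace → σ.toTopologicalSpace = τ

/-- A minimal group `G` is *z-minimal* if `G/Z(G)` (with the quotient topology) is minimal. -/
def IsZMinimal (G : Type*) [Group G] [TopologicalSpace G] : Prop :=
  IsMinimal G ∧ IsMinimal (G ⧸ Subgroup.center G)

/-- `SL(n,F)` carries the pointwise topology inherited from `F^(n²)`. -/
instance {m : Type*} [DecidableEq m] [Fintype m] {R : Type*} [CommRing R]
    [TopologicalSpace R] : TopologicalSpace (Matrix.SpecialLinearGroup m R) :=
  inferInstanceAs (TopologicalSpace { A : Matrix m m R // A.det = 1 })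

/-- `QPadic p hp` is the field `ℚ` of rational numbers equipped with the `p`-adic topology,
i.e. the topology induced by the `p`-adic norm (equivalently, induced by the inclusion
`ℚ → ℚ_[p]`). -/
def QPadic (p : ℕ) (hp : p.Prime) : Type := ℚ

instance (p : ℕ) (hp : p.Prime) : Field (QPadic p hp) := inferInstanceAs (Field ℚ)

noncomputable instance (p : ℕ) (hp : p.Prime) : TopologicalSpace (QPadic p hp) :=
  haveI : Fact p.Prime := ⟨hp⟩
  TopologicalSpace.induced (fun q : ℚ => (q : ℚ_[p])) inferInstance

open Filter Topology

namespace Matrix.SpecialLinearGroup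

variable {ι K : Type*} [Fintype ι] [DecidableEq ι] [Field K]

/-- The transvection `1 + v wᵀ` attached to a column `v` and a row `w` with `w ⬝ᵥ v = 0`. -/
def dyadic (v w : ι → K) (h : w ⬝ᵥ v = 0) : SpecialLinearGroup ι K :=
  ⟨1 + vecMulVec v w, by
    rw [vecMulVec_eq Unit, det_one_add_replicateCol_mul_replicateRow, h, add_zero]⟩

theorem coe_dyadic (v w : ι → K) (h : w ⬝ᵥ v = 0) :
    (dyadic v w h : Matrix ι ι K) = 1 + vecMulVec v w := rfl

theorem dyadic_inv (v w : ι → K) (h : w ⬝ᵥ v = 0) :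
    (dyadic v w h)⁻¹ = dyadic (-v) w (by simp [h]) := by
  refine inv_eq_of_mul_eq_one_right (Subtype.ext ?_)
  simp [coe_dyadic, add_mul, mul_add, vecMulVec_mul_vecMulVec, h, neg_vecMulVec]

theorem conj_dyadic (x : SpecialLinearGroup ι K) (v w : ι → K) (h : w ⬝ᵥ v = 0) :
    (↑(x * dyadic v w h * x⁻¹) : Matrix ι ι K) =
      1 + vecMulVec ((x : Matrix ι ι K) *ᵥ v) (w ᵥ* (↑x⁻¹ : Matrix ι ι K)) := by
  have hx : (x : Matrix ι ι K) * (↑x⁻¹ : Matrix ι ι K) = 1 := by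
    rw [← coe_mul, mul_inv_cancel, coe_one]
  rw [coe_mul, coe_mul, coe_dyadic, mul_add, add_mul, mul_one, hx, mul_vecMulVec, vecMulVec_mul]

/-- If `x` fixes `v`, then the commutator of `x` with `1 + v wᵀ` is again a transvection. -/
theorem commutator_dyadic (x : SpecialLinearGroup ι K) (v w : ι → K) (h : w ⬝ᵥ v = 0)
    (hx : (x : Matrix ι ι K) *ᵥ v = v)
    (h' : (w ᵥ* (↑x⁻¹ : Matrix ι ι K) - w) ⬝ᵥ v = 0) :
    x * dyadic v w h * x⁻¹ * (dyadic v w h)⁻¹ =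
      dyadic v (w ᵥ* (↑x⁻¹ : Matrix ι ι K) - w) h' := by
  refine Subtype.ext ?_
  have h2 : (w ᵥ* (↑x⁻¹ : Matrix ι ι K)) ⬝ᵥ v = 0 := by
    rwa [sub_dotProduct, h, sub_zero] at h'
  rw [coe_mul, conj_dyadic, hx, dyadic_inv, coe_dyadic, coe_dyadic]
  simp only [add_mul, mul_add, vecMulVec_mul_vecMulVec, one_mul, mul_one, neg_vecMulVec,
    h2, zero_smul, vecMulVec_sub, vecMulVec_zero, mul_neg]
  abel

variable {N : Subgroup (SpecialLinearGroup ι K)} [hN : N.Normal]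

theorem dyadic_mem_of_row {v w u q : ι → K} (hwv : w ⬝ᵥ v = 0)
    (hmem : dyadic v w hwv ∈ N) (huv : u ⬝ᵥ v = 0) (huq : u ⬝ᵥ q = 0) (hwq : w ⬝ᵥ q = 1) :
    dyadic v u huv ∈ N := by
  have key : dyadic v w hwv * (dyadic q u huq * (dyadic v w hwv)⁻¹ * (dyadic q u huq)⁻¹) =
      dyadic v u huv := by
    rw [← mul_assoc, ← mul_assoc]
    refine Subtype.ext ?_
    rw [coe_mul, conj_dyadic, dyadic_inv, dyadic_inv, coe_dyadic, coe_dyadic, coe_dyadic,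
      coe_dyadic]
    simp only [add_mulVec, one_mulVec, vecMulVec_mulVec, hwq, vecMul_add, vecMul_one,
      vecMul_vecMulVec, dotProduct_neg, huv, add_mul, mul_add, vecMulVec_mul_vecMulVec]
    simp [add_vecMulVec, neg_vecMulVec, huq]
    abel
  rw [← key]
  exact N.mul_mem hmem (hN.conj_mem _ (N.inv_mem hmem) _)

theorem dyadic_mem_of_col {v u v' q : ι → K} (huv : u ⬝ᵥ v = 0)
    (hmem : dyadic v u huv ∈ N) (huv' : u ⬝ᵥ v' = 0) (hqv' : q ⬝ᵥ v' = 0) (hqv : q ⬝ᵥ v = 1) :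
    dyadic v' u huv' ∈ N := by
  have key : dyadic v' q hqv' * dyadic v u huv * (dyadic v' q hqv')⁻¹ * (dyadic v u huv)⁻¹ =
      dyadic v' u huv' := by
    refine Subtype.ext ?_
    rw [coe_mul, conj_dyadic, dyadic_inv, dyadic_inv, coe_dyadic, coe_dyadic, coe_dyadic,
      coe_dyadic]
    simp only [add_mulVec, one_mulVec, vecMulVec_mulVec, hqv, vecMul_add, vecMul_one,
      vecMul_vecMulVec, dotProduct_neg, huv', add_mul, mul_add, vecMulVec_mul_vecMulVec]
    simp [add_vecMulVec, neg_vecMulVec, huv]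
    abel
  rw [← key]
  exact N.mul_mem (hN.conj_mem _ hmem _) (N.inv_mem hmem)

theorem exists_transvection_mem_of_dyadic_mem (hι : 3 ≤ Fintype.card ι) {v w : ι → K}
    (hv : v ≠ 0) (hw : w ≠ 0) (hwv : w ⬝ᵥ v = 0) (hmem : dyadic v w hwv ∈ N) :
    ∃ (i j : ι) (hij : i ≠ j), transvection hij (1 : K) ∈ N := by
  obtain ⟨i, hi⟩ := Function.ne_iff.1 hv
  have hi : v i ≠ 0 := hi
  obtain ⟨m, hmi, hm⟩ : ∃ m, m ≠ i ∧ w m ≠ 0 := by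
    by_contra! hcon
    have : w = Pi.single i (w i) := by
      ext m
      by_cases h : m = i
      · subst h; simp
      · simp [h, hcon m h]
    rw [this, single_dotProduct] at hwv
    rcases mul_eq_zero.1 hwv with h | h
    · exact hw (by rw [this, h, Pi.single_zero])
    · exact hi h
  obtain ⟨j, hj⟩ : ∃ j, j ∉ ({i, m} : Finset ι) := by
    by_contra! hcon
    have : Finset.univ ⊆ ({i, m} : Finset ι) := fun x _ => hcon x
    have := (Finset.card_le_card this).trans Finset.card_le_two
    rw [Finset.card_univ] at this
    omega
  obtain ⟨hji, hjm⟩ : j ≠ i ∧ j ≠ m := by simpa using hj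
  set c : K := -(v j / v i) with hc
  set u : ι → K := Pi.single j 1 + Pi.single i c with hu
  have huv : u ⬝ᵥ v = 0 := by
    rw [hu, add_dotProduct, single_dotProduct, single_dotProduct, hc]
    field_simp
    ring
  have h1 : dyadic v u huv ∈ N :=
    dyadic_mem_of_row (q := Pi.single m (w m)⁻¹) hwv hmem huv
      (by simp [hu, hmi, hjm.symm]) (by simp [hm])
  have hum : u ⬝ᵥ Pi.single m 1 = 0 := by simp [hu, hmi, hjm.symm]
  have h2 : dyadic (Pi.single m 1) u hum ∈ N :=
    dyadic_mem_of_col (q := Pi.single i (v i)⁻¹) huv h1 hum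
      (by simp [hmi]) (by simp [hi])
  have hjm' : (Pi.single j 1 : ι → K) ⬝ᵥ Pi.single m 1 = 0 := by simp [hjm]
  have h3 : dyadic (Pi.single m 1) (Pi.single j 1 : ι → K) hjm' ∈ N := by
    by_cases hc0 : c = 0
    · have : u = Pi.single j 1 := by rw [hu, hc0, Pi.single_zero, add_zero]
      simpa only [this] using h2
    · exact dyadic_mem_of_row (q := Pi.single i c⁻¹) hum h2 hjm' (by simp [hji])
        (by simp [hu, hc0, hji.symm])
  refine ⟨m, j, hjm.symm, ?_⟩
  convert h3 using 1
  refine Subtype.ext ?_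
  rw [transvection_coe, coe_dyadic, single_eq_single_vecMulVec_single]

/-- A normal subgroup of `SL(n, K)`, `n ≥ 3`, that contains no elementary transvection with
coefficient `1` is central. -/
theorem normal_le_center (hι : 3 ≤ Fintype.card ι)
    (h : ∀ (i j : ι) (hij : i ≠ j), transvection hij (1 : K) ∉ N) :
    N ≤ Subgroup.center (SpecialLinearGroup ι K) := by
  have hdy : ∀ (v w : ι → K) (hwv : w ⬝ᵥ v = 0), v ≠ 0 → dyadic v w hwv ∈ N → w = 0 := by
    intro v w hwv hv hmem
    by_contra hw
    obtain ⟨i, j, hij, hm⟩ := exists_transvection_mem_of_dyadic_mem hι hv hw hwv hmem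
    exact h i j hij hm
  intro x hx
  suffices hcomm : ∀ t : TransvectionStruct ι K, Commute t.toMatrix (x : Matrix ι ι K) by
    obtain ⟨r, hr⟩ := mem_range_scalar_of_commute_transvectionStruct hcomm
    refine mem_center_iff.2 ⟨r, ?_, hr⟩
    have := x.det_coe
    rwa [← hr, scalar_apply, det_diagonal, Finset.prod_const, Finset.card_univ] at this
  intro t
  obtain ⟨a, b, hab, c⟩ := t
  set e : SpecialLinearGroup ι K := dyadic (Pi.single a c) (Pi.single b 1) (by simp [hab]) with he
  have hee : (e : Matrix ι ι K) = (TransvectionStruct.mk a b hab c).toMatrix := by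
    ext i j
    simp [he, coe_dyadic, TransvectionStruct.toMatrix, Matrix.transvection, vecMulVec_apply,
      Matrix.single_apply, Pi.single_apply, eq_comm]
    grind
  set y := x * e * x⁻¹ * e⁻¹ with hy
  have hyN : y ∈ N := by
    have : y = x * (e * x⁻¹ * e⁻¹) := by simp [hy, mul_assoc]
    rw [this]
    exact N.mul_mem hx (hN.conj_mem _ (N.inv_mem hx) _)
  suffices hy1 : y = 1 by
    have h1 : x * e = e * x := by
      rwa [hy, mul_inv_eq_one, mul_inv_eq_iff_eq_mul] at hy1
    rw [← hee]
    change (e : Matrix ι ι K) * x = x * e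
    rw [← coe_mul, ← coe_mul, h1]
  -- a nonzero vector fixed by `y`
  set r : ι → K := Pi.single b 1 ᵥ* (↑x⁻¹ : Matrix ι ι K) with hr
  let f : (ι → K) →ₗ[K] (Fin 2 → K) :=
    (Matrix.of ![r, Pi.single b 1]).mulVecLin
  obtain ⟨v, hvf, hv⟩ : ∃ v ∈ LinearMap.ker f, v ≠ 0 := by
    refine Submodule.exists_mem_ne_zero_of_ne_bot (LinearMap.ker_ne_bot_of_finrank_lt ?_)
    simp
    omega
  have hvr : r ⬝ᵥ v = 0 := congrFun (LinearMap.mem_ker.1 hvf) 0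
  have hvb : (Pi.single b 1 : ι → K) ⬝ᵥ v = 0 := congrFun (LinearMap.mem_ker.1 hvf) 1
  have hyv : (y : Matrix ι ι K) *ᵥ v = v := by
    rw [hy, coe_mul, he, conj_dyadic, dyadic_inv, coe_dyadic, ← mulVec_mulVec, add_mulVec _ _ v,
      vecMulVec_mulVec _ _ v, hvb]
    simp only [MulOpposite.op_zero, zero_smul, add_zero, one_mulVec]
    rw [add_mulVec, vecMulVec_mulVec, ← hr, hvr]
    simp
  have hyv' : (↑y⁻¹ : Matrix ι ι K) *ᵥ v = v := by
    conv_lhs => rw [← hyv]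
    rw [mulVec_mulVec, ← coe_mul, inv_mul_cancel, coe_one, one_mulVec]
  have hrow : ∀ w : ι → K, w ⬝ᵥ v = 0 → w ᵥ* (↑y⁻¹ : Matrix ι ι K) = w := by
    intro w hw
    have h' : (w ᵥ* (↑y⁻¹ : Matrix ι ι K) - w) ⬝ᵥ v = 0 := by
      rw [sub_dotProduct, ← dotProduct_mulVec, hyv', sub_self]
    refine sub_eq_zero.1 (hdy v _ h' hv ?_)
    rw [← commutator_dyadic y v w hw hyv h']
    have : y * dyadic v w hw * y⁻¹ * (dyadic v w hw)⁻¹ =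
      y * (dyadic v w hw * y⁻¹ * (dyadic v w hw)⁻¹) := by simp [mul_assoc]
    rw [this]
    exact N.mul_mem hyN (hN.conj_mem _ (N.inv_mem hyN) _)
  obtain ⟨i, hi⟩ := Function.ne_iff.1 hv
  have hi : v i ≠ 0 := hi
  set Z : Matrix ι ι K := (↑y⁻¹ : Matrix ι ι K) - 1 with hZ
  have hZv : Z *ᵥ v = 0 := by rw [hZ, sub_mulVec, hyv', one_mulVec, sub_self]
  set s : ι → K := (v i)⁻¹ • Z i with hs
  have hsv : s ⬝ᵥ v = 0 := by
    rw [hs, smul_dotProduct, show Z i ⬝ᵥ v = 0 from congrFun hZv i, smul_zero]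
  have hZs : Z = vecMulVec v s := by
    ext j k
    have h1 := hrow (Pi.single j 1 + Pi.single i (-(v j / v i))) (by
      rw [add_dotProduct, single_dotProduct, single_dotProduct]; field_simp; ring)
    have h2 : (Pi.single j 1 + Pi.single i (-(v j / v i)) : ι → K) ᵥ* Z = 0 := by
      rw [hZ, vecMul_sub, h1, vecMul_one, sub_self]
    have h3 := congrFun h2 k
    simp [add_vecMul] at h3
    rw [vecMulVec_apply, hs, Pi.smul_apply, smul_eq_mul]
    linear_combination h3
  have hyd : y⁻¹ = dyadic v s hsv := by
    refine Subtype.ext ?_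
    rw [coe_dyadic, ← hZs, hZ]
    abel
  have hs0 : s = 0 := hdy v s hsv hv (hyd ▸ N.inv_mem hyN)
  rw [← inv_eq_one, hyd]
  refine Subtype.ext ?_
  rw [coe_dyadic, hs0, vecMulVec_zero, add_zero, coe_one]

end Matrix.SpecialLinearGroup

section Ker
variable {Γ H G : Type*} [Group Γ] [Group H] [TopologicalSpace H] [IsTopologicalGroup H]
  [Group G] [TopologicalSpace G] [IsTopologicalGroup G]

theorem tendsto_conj_one_of_comap {i : Γ →* H} {e : Γ →* G} (hi : DenseRange i)
    (he : Tendsto e (comap i (𝓝 1)) (𝓝 1)) (h : H) {F : Filter Γ}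
    (hF : Tendsto e F (𝓝 1)) :
    Tendsto (fun x : Γ × Γ => e (x.2 * x.1 * x.2⁻¹)) (F ×ˢ comap i (𝓝 h)) (𝓝 1) := by
  have hc : Tendsto (fun x : G × G => x.1 * x.2 * x.1⁻¹) (𝓝 1 ×ˢ 𝓝 1) (𝓝 1) := by
    rw [← nhds_prod_eq]
    have : Continuous (fun x : G × G => x.1 * x.2 * x.1⁻¹) := by fun_prop
    simpa using this.tendsto (1, 1)
  have hd : Tendsto (fun x : H × H => x.1 * x.2⁻¹) (𝓝 h ×ˢ 𝓝 h) (𝓝 1) := by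
    rw [← nhds_prod_eq]
    have : Continuous (fun x : H × H => x.1 * x.2⁻¹) := by fun_prop
    simpa using this.tendsto (h, h)
  intro U hU
  obtain ⟨V, hV, V', hV', hVU⟩ := mem_prod_iff.1 (hc hU)
  obtain ⟨O, hO, hOV⟩ := mem_comap.1 (he hV)
  obtain ⟨A, hA, B, hB, hAB⟩ := mem_prod_iff.1 (hd hO)
  obtain ⟨d, hdB⟩ : ∃ d, i d ∈ B := hi.exists_mem_open isOpen_interior
    ⟨h, mem_interior_iff_mem_nhds.2 hB⟩ |>.imp fun _ => (interior_subset ·)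
  have h1 : ∀ᶠ γ in F, e d * e γ * (e d)⁻¹ ∈ V' := by
    have : Tendsto (fun γ => e d * e γ * (e d)⁻¹) F (𝓝 (e d * 1 * (e d)⁻¹)) :=
      (hF.const_mul _).mul_const _
    rw [mul_one, mul_inv_cancel] at this
    exact this hV'
  have h2 : ∀ᶠ δ in comap i (𝓝 h), e (δ * d⁻¹) ∈ V := by
    filter_upwards [preimage_mem_comap hA] with δ hδ
    have : i (δ * d⁻¹) ∈ O := by
      rw [map_mul, map_inv]
      exact hAB (Set.mk_mem_prod hδ hdB)
    exact hOV this
  refine (h1.prod_mk h2).mono fun x hx => ?_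
  have := hVU (Set.mk_mem_prod hx.2 hx.1)
  simpa [mul_assoc] using this

/-- Limits, along `i`, of filters on `Γ` which tend to `1` along `e`: this is the kernel of the
extension of `e` to the completion `H` of `Γ`. -/
def limitKernel (i : Γ →* H) (e : Γ →* G) : Subgroup H where
  carrier := {x | ∃ F : Filter Γ, F.NeBot ∧ Tendsto i F (𝓝 x) ∧ Tendsto e F (𝓝 1)}
  one_mem' := ⟨pure 1, inferInstance, by simpa using tendsto_pure_nhds i 1,
    by simpa using tendsto_pure_nhds e 1⟩
  mul_mem' := by
    rintro x y ⟨F, hF, hFx, hF1⟩ ⟨F', hF', hFy, hF1'⟩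
    refine ⟨map (fun z : Γ × Γ => z.1 * z.2) (F ×ˢ F'), inferInstance, ?_, ?_⟩
    · simpa [tendsto_map'_iff, Function.comp_def] using
        (hFx.comp tendsto_fst).mul (hFy.comp tendsto_snd)
    · simpa [tendsto_map'_iff, Function.comp_def] using
        (hF1.comp tendsto_fst).mul (hF1'.comp tendsto_snd)
  inv_mem' := by
    rintro x ⟨F, hF, hFx, hF1⟩
    refine ⟨map (fun z : Γ => z⁻¹) F, inferInstance, ?_, ?_⟩
    · refine tendsto_map'_iff.2 ?_
      simpa [Function.comp_def] using hFx.inv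
    · refine tendsto_map'_iff.2 ?_
      simpa [Function.comp_def] using hF1.inv

theorem mem_limitKernel_of_tendsto {i : Γ →* H} {e : Γ →* G} {x : H} {α : Type*} {F : Filter α}
    [F.NeBot] {u : α → Γ} (hi : Tendsto (fun a => i (u a)) F (𝓝 x))
    (he : Tendsto (fun a => e (u a)) F (𝓝 1)) : x ∈ limitKernel i e :=
  ⟨map u F, inferInstance, tendsto_map'_iff.2 hi,
    tendsto_map'_iff.2 he⟩

theorem limitKernel_normal {i : Γ →* H} {e : Γ →* G} (hi : DenseRange i)
    (he : Tendsto e (comap i (𝓝 1)) (𝓝 1)) : (limitKernel i e).Normal where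
  conj_mem := by
    rintro x ⟨F, hF, hFx, hF1⟩ h
    have : (comap i (𝓝 h)).NeBot := comap_neBot fun t ht => (hi.mem_nhds ht)
    refine mem_limitKernel_of_tendsto (u := fun z : Γ × Γ => z.2 * z.1 * z.2⁻¹) ?_
      (tendsto_conj_one_of_comap hi he h hF1)
    have h2 : Tendsto (fun z : Γ × Γ => i z.2) (F ×ˢ comap i (𝓝 h)) (𝓝 h) :=
      tendsto_comap.comp tendsto_snd
    simpa using (h2.mul (hFx.comp tendsto_fst)).mul h2.inv

theorem eq_one_of_mem_limitKernel [T2Space G] {i : Γ →* H} {e : Γ →* G}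
    (he : Tendsto e (comap i (𝓝 1)) (𝓝 1)) {γ : Γ} (h : i γ ∈ limitKernel i e) : e γ = 1 := by
  obtain ⟨F, hF, hFx, hF1⟩ := h
  have h1 : Tendsto (fun δ => δ * γ⁻¹) F (comap i (𝓝 1)) := by
    refine tendsto_comap_iff.2 ?_
    simpa [Function.comp_def] using hFx.mul_const (i γ)⁻¹
  have h2 : Tendsto (fun δ => e (δ * γ⁻¹)) F (𝓝 1) := he.comp h1
  have h3 : Tendsto (fun δ => e (δ * γ⁻¹)) F (𝓝 (e γ)⁻¹) := by
    simpa using hF1.mul_const (e γ)⁻¹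
  exact inv_eq_one.1 (tendsto_nhds_unique h3 h2)

end Ker

namespace Matrix.SpecialLinearGroup

section Topology
variable {ι K : Type*} [Fintype ι] [DecidableEq ι]

instance isTopologicalGroup [CommRing K] [TopologicalSpace K] [IsTopologicalRing K] :
    IsTopologicalGroup (SpecialLinearGroup ι K) :=
  topologicalGroup

theorem tendsto_iff_coe [CommRing K] [TopologicalSpace K] {α : Type*} {l : Filter α}
    {u : α → SpecialLinearGroup ι K} {x : SpecialLinearGroup ι K} :
    Tendsto u l (𝓝 x) ↔
      Tendsto (fun a => (u a : Matrix ι ι K)) l (𝓝 (x : Matrix ι ι K)) :=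
  (Topology.IsInducing.subtypeVal (t := {A : Matrix ι ι K | A.det = 1})).tendsto_nhds_iff

theorem tendsto_iff_apply [CommRing K] [TopologicalSpace K] {α : Type*} {l : Filter α}
    {u : α → SpecialLinearGroup ι K} {x : SpecialLinearGroup ι K} :
    Tendsto u l (𝓝 x) ↔ ∀ i j, Tendsto (fun a => u a i j) l (𝓝 (x i j)) := by
  exact tendsto_iff_coe.trans (tendsto_pi_nhds.trans (forall_congr' fun _ => tendsto_pi_nhds))

theorem exists_tendsto_of_coe [CommRing K] [TopologicalSpace K] [IsTopologicalRing K] [T2Space K]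
    {α : Type*} {l : Filter α} [l.NeBot] {u : α → SpecialLinearGroup ι K} {M : Matrix ι ι K}
    (h : Tendsto (fun a => (u a : Matrix ι ι K)) l (𝓝 M)) :
    ∃ x : SpecialLinearGroup ι K, (x : Matrix ι ι K) = M ∧ Tendsto u l (𝓝 x) := by
  have hdet : Tendsto (fun a => (u a : Matrix ι ι K).det) l (𝓝 M.det) :=
    (Continuous.matrix_det continuous_id).continuousAt.tendsto.comp h
  simp only [det_coe] at hdet
  exact ⟨⟨M, tendsto_nhds_unique hdet tendsto_const_nhds⟩, rfl, tendsto_iff_coe.2 h⟩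

/-- A dense subfield gives a dense subgroup of the special linear group. -/
theorem denseRange_map [Nonempty ι] {k : Type*} [Field k] [Field K] [TopologicalSpace K]
    [IsTopologicalRing K] [ContinuousInv₀ K] [T2Space K] {φ : k →+* K} (hφ : DenseRange φ) :
    DenseRange (map φ : SpecialLinearGroup ι k →* SpecialLinearGroup ι K) := by
  classical
  intro x
  let i₀ : ι := Classical.arbitrary ι
  have hden : DenseRange (φ.mapMatrix : Matrix ι ι k → Matrix ι ι K) := by
    have := DenseRange.piMap (fun _ : ι => DenseRange.piMap fun _ : ι => hφ)
    exact this
  set l : Filter (Matrix ι ι k) := comap φ.mapMatrix (𝓝 (x : Matrix ι ι K)) with hl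
  have : l.NeBot := comap_neBot fun t ht => hden.mem_nhds ht
  have hlim : Tendsto φ.mapMatrix l (𝓝 (x : Matrix ι ι K)) := tendsto_comap
  have hdet : Tendsto (fun M => φ M.det) l (𝓝 1) := by
    have h1 : Tendsto (fun M => (φ.mapMatrix M).det) l (𝓝 (x : Matrix ι ι K).det) :=
      (Continuous.matrix_det continuous_id).continuousAt.tendsto.comp hlim
    simpa only [← RingHom.map_det, det_coe] using h1
  have hne : ∀ᶠ M in l, M.det ≠ 0 := by
    filter_upwards [hdet.eventually_ne one_ne_zero] with M hM h0
    exact hM (by rw [h0, map_zero])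
  let s : Matrix ι ι k → SpecialLinearGroup ι k := fun M =>
    if h : M.det ≠ 0 then ⟨M.updateRow i₀ (M.det⁻¹ • M i₀), by
      rw [det_updateRow_smul, updateRow_eq_self, inv_mul_cancel₀ h]⟩ else 1
  have hs_apply {M : Matrix ι ι k} (hM : M.det ≠ 0) (i j : ι) :
      map φ (s M) i j = φ (M.updateRow i₀ (M.det⁻¹ • M i₀) i j) := by
    have : s M = ⟨_, _⟩ := dif_pos hM
    rw [this]
    rfl
  have hs : Tendsto (fun M => map φ (s M)) l (𝓝 x) := by
    rw [tendsto_iff_apply]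
    intro i j
    have hij : Tendsto (fun M => φ (M i j)) l (𝓝 (x i j)) :=
      ((continuous_apply_apply i j).tendsto _).comp hlim
    by_cases hi : i = i₀
    · have h2 : Tendsto (fun M => (φ M.det)⁻¹ * φ (M i j)) l (𝓝 (x i j)) := by
        simpa using (hdet.inv₀ one_ne_zero).mul hij
      refine h2.congr' ?_
      filter_upwards [hne] with M hM
      rw [hs_apply hM, hi]
      simp
    · refine hij.congr' ?_
      filter_upwards [hne] with M hM
      rw [hs_apply hM, updateRow_ne hi]
  exact mem_closure_of_tendsto hs (Eventually.of_forall fun M => Set.mem_range_self _)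

end Topology

theorem _root_.Ultrafilter.exists_tendsto_of_norm_le {α E : Type*}
    [SeminormedAddCommGroup E] [ProperSpace E] {l : Ultrafilter α} {f : α → E} {C : ℝ}
    (h : ∀ᶠ a in (l : Filter α), ‖f a‖ ≤ C) : ∃ x, Tendsto f l (𝓝 x) := by
  obtain ⟨x, -, hx⟩ := (isCompact_closedBall (0 : E) C).ultrafilter_le_nhds (l.map f) <| by
    rw [le_principal_iff]
    exact h.mono fun a ha => by simpa using ha
  exact ⟨x, hx⟩

/-- Along an ultrafilter, a function with values in a proper space either converges or is
unbounded. -/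
theorem _root_.Ultrafilter.exists_tendsto_or_tendsto_norm_atTop {α E : Type*}
    [SeminormedAddCommGroup E] [ProperSpace E] (l : Ultrafilter α) (f : α → E) :
    (∃ x, Tendsto f l (𝓝 x)) ∨ Tendsto (fun a => ‖f a‖) l atTop := by
  by_cases h : ∃ C, ∀ᶠ a in (l : Filter α), ‖f a‖ ≤ C
  · obtain ⟨C, hC⟩ := h
    exact .inl (Ultrafilter.exists_tendsto_of_norm_le hC)
  · push Not at h
    exact .inr (tendsto_atTop.2 fun C => (h C).mono fun a ha => ha.le)

section Main

variable {ι k K G : Type*} [Fintype ι] [DecidableEq ι] [Field k] [NontriviallyNormedField K]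
  [Group G] [TopologicalSpace G] [IsTopologicalGroup G] [T2Space G]

omit [Group G] [TopologicalSpace G] [IsTopologicalGroup G] [T2Space G] in
theorem map_transvection_one (φ : k →+* K) {a b : ι} (hab : a ≠ b) :
    map φ (transvection hab (1 : k)) = transvection hab (1 : K) := by
  refine Subtype.ext ?_
  ext i j
  simp [transvection_coe, Matrix.add_apply, Matrix.one_apply, Matrix.single_apply, apply_ite φ]

theorem limitKernel_le_center (hι : 3 ≤ Fintype.card ι) {φ : k →+* K} (hφ : DenseRange φ)
    {e : SpecialLinearGroup ι k →* G} (he_inj : Function.Injective e)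
    (he : Tendsto e (comap (map φ) (𝓝 1)) (𝓝 1)) :
      limitKernel (map φ) e ≤ Subgroup.center (SpecialLinearGroup ι K) := by
  have : Nonempty ι := Fintype.card_pos_iff.1 (by omega)
  have := limitKernel_normal (denseRange_map (ι := ι) hφ) he
  refine normal_le_center hι fun i j hij hmem => ?_
  rw [← map_transvection_one φ] at hmem
  have h2 := he_inj ((eq_one_of_mem_limitKernel he hmem).trans (map_one e).symm)
  have h3 := congrArg (fun A : SpecialLinearGroup ι k => A i j) h2
  simp [transvection_coe, hij] at h3

/-- The conjugate of the matrix unit at `(a, b)` by `x`. -/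
def conjSingle (x : SpecialLinearGroup ι k) (a b : ι) : Matrix ι ι k :=
  (x : Matrix ι ι k) * single a b 1 * (↑x⁻¹ : Matrix ι ι k)

theorem conjSingle_apply (x : SpecialLinearGroup ι k) (a b i j : ι) :
    conjSingle x a b i j = x i a * x⁻¹ b j := by
  rw [conjSingle, single_eq_single_vecMulVec_single, mul_vecMulVec, vecMulVec_mul,
    vecMulVec_apply]
  simp

theorem conjSingle_mul (x : SpecialLinearGroup ι k) (a b c d : ι) :
    conjSingle x a b * conjSingle x c d =
      (x : Matrix ι ι k) * (single a b 1 * single c d 1) * (↑x⁻¹ : Matrix ι ι k) := by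
  have hx : (↑x⁻¹ : Matrix ι ι k) * (x : Matrix ι ι k) = 1 := by
    rw [← coe_mul, inv_mul_cancel, coe_one]
  calc _ = (x : Matrix ι ι k) * single a b 1 * ((↑x⁻¹ : Matrix ι ι k) * (x : Matrix ι ι k)) *
      single c d 1 * (↑x⁻¹ : Matrix ι ι k) := by simp only [conjSingle, Matrix.mul_assoc]
    _ = _ := by rw [hx, Matrix.mul_one]; simp only [Matrix.mul_assoc]

theorem coe_conj_transvection (x : SpecialLinearGroup ι k) {a b : ι} (hab : a ≠ b) (t : k) :
    (↑(x * transvection hab t * x⁻¹) : Matrix ι ι k) = 1 + t • conjSingle x a b := by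
  have hx : (x : Matrix ι ι k) * (↑x⁻¹ : Matrix ι ι k) = 1 := by
    rw [← coe_mul, mul_inv_cancel, coe_one]
  have ht : single a b t = t • single a b (1 : k) := by simp
  rw [coe_mul, coe_mul, transvection_coe, mul_add, add_mul, mul_one, hx, ht, conjSingle,
    Matrix.mul_smul, Matrix.smul_mul]

variable [ProperSpace K]

omit [T2Space G] in
theorem exists_tendsto_conjSingle_of_ne {φ : k →+* K} {e : SpecialLinearGroup ι k →* G}
    (he : Tendsto e (comap (map φ) (𝓝 1)) (𝓝 1))
    (hcen : limitKernel (map φ) e ≤ Subgroup.center (SpecialLinearGroup ι K))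
    {π : G →* SpecialLinearGroup ι k}
    (hconj : ∀ g a, g * e a * g⁻¹ = e (π g * a * (π g)⁻¹))
    {l : Ultrafilter G} (hl : (l : Filter G) ≤ 𝓝 1) {a b : ι} (hab : a ≠ b) (i j : ι) :
    ∃ x, Tendsto (fun g => φ (conjSingle (π g) a b i j)) l (𝓝 x) := by
  obtain h | hinf := Ultrafilter.exists_tendsto_or_tendsto_norm_atTop l
    (fun g => φ (conjSingle (π g) a b i j))
  · exact h
  exfalso
  obtain ⟨⟨i', j'⟩, hmax⟩ : ∃ q : ι × ι, ∀ᶠ g in (l : Filter G), ∀ q' : ι × ι,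
      ‖φ (conjSingle (π g) a b q'.1 q'.2)‖ ≤ ‖φ (conjSingle (π g) a b q.1 q.2)‖ := by
    refine Ultrafilter.eventually_exists_iff.1 (Eventually.of_forall fun g => ?_)
    have : Nonempty (ι × ι) := ⟨(a, b)⟩
    exact Finite.exists_max (fun q : ι × ι => ‖φ (conjSingle (π g) a b q.1 q.2)‖)
  set t : G → k := fun g => (conjSingle (π g) a b i' j')⁻¹ with ht
  have htop : Tendsto (fun g => ‖φ (conjSingle (π g) a b i' j')‖) l atTop :=
    tendsto_atTop_mono' _ (hmax.mono fun g hg => hg (i, j)) hinf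
  have ht0 : Tendsto (fun g => φ (t g)) l (𝓝 0) := by
    rw [tendsto_zero_iff_norm_tendsto_zero]
    simpa [ht, Function.comp_def] using tendsto_inv_atTop_zero.comp htop
  have hpos := htop.eventually_gt_atTop 0
  have hbd : ∀ q : ι × ι, ∃ x,
      Tendsto (fun g => φ (t g) * φ (conjSingle (π g) a b q.1 q.2)) l (𝓝 x) := by
    intro q
    refine Ultrafilter.exists_tendsto_of_norm_le (C := 1) ?_
    filter_upwards [hmax, hpos] with g hg hg0
    rw [ht, map_inv₀, norm_mul, norm_inv, inv_mul_le_iff₀ hg0, mul_one]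
    exact hg q
  choose L' hL' using hbd
  set L : Matrix ι ι K := Matrix.of fun i j => L' (i, j) with hLdef
  have hL : Tendsto (fun g => φ.mapMatrix (t g • conjSingle (π g) a b)) l (𝓝 L) := by
    refine tendsto_pi_nhds.2 fun i => tendsto_pi_nhds.2 fun j => ?_
    refine (hL' (i, j)).congr fun g => ?_
    simp
  have hL1 : L i' j' = 1 := by
    refine tendsto_nhds_unique (hL' (i', j')) (tendsto_const_nhds.congr' ?_)
    filter_upwards [hpos] with g hg
    rw [ht, map_inv₀, inv_mul_cancel₀ (norm_pos_iff.1 hg)]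
  have hLL : L * L = 0 := by
    refine tendsto_nhds_unique (hL.mul hL) (tendsto_const_nhds.congr fun g => ?_)
    rw [← map_mul, Matrix.smul_mul, Matrix.mul_smul, conjSingle_mul,
      single_mul_single_of_ne _ _ _ _ hab.symm]
    simp
  set w : G → SpecialLinearGroup ι k := fun g => π g * transvection hab (t g) * (π g)⁻¹ with hw
  have hwL : Tendsto (fun g => (map φ (w g) : Matrix ι ι K)) l (𝓝 (1 + L)) := by
    refine (hL.const_add 1).congr fun g => ?_
    rw [map_apply_coe, hw, coe_conj_transvection, map_add, map_one]
  obtain ⟨x, hxL, hx⟩ := exists_tendsto_of_coe hwL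
  have hTt : Tendsto (fun g => e (transvection hab (t g))) l (𝓝 1) := by
    refine he.comp (tendsto_comap_iff.2 (tendsto_iff_apply.2 fun i j => ?_))
    have h1 : Tendsto (fun g => (1 : Matrix ι ι K) i j + φ (t g) * (single a b (1 : K) i j)) l
        (𝓝 ((1 : Matrix ι ι K) i j + 0 * (single a b (1 : K) i j))) :=
      (ht0.mul_const _).const_add _
    rw [zero_mul, add_zero] at h1
    refine h1.congr fun g => ?_
    simp [transvection_coe, Matrix.add_apply, Matrix.one_apply, Matrix.single_apply, apply_ite φ]
  have hew : Tendsto (fun g => e (w g)) l (𝓝 1) := by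
    have hid : Tendsto (fun g : G => g) l (𝓝 1) := hl
    have h1 := (hid.mul hTt).mul hid.inv
    simp only [mul_one, inv_one] at h1
    exact h1.congr fun g => hconj g _
  obtain ⟨r, -, hr⟩ := mem_center_iff.1 (hcen (mem_limitKernel_of_tendsto hx hew))
  have hLr : L = scalar ι (r - 1) := by
    rw [map_sub, map_one, hr, hxL, add_sub_cancel_left]
  have hr0 : r - 1 = 0 := by
    rw [hLr, ← map_mul] at hLL
    have := congrFun (congrFun hLL i) i
    simpa using this
  rw [hLr, hr0, map_zero] at hL1
  exact zero_ne_one hL1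

omit [T2Space G] in
theorem exists_tendsto_conjSingle (hι : 3 ≤ Fintype.card ι) {φ : k →+* K}
    {e : SpecialLinearGroup ι k →* G}
    (he : Tendsto e (comap (map φ) (𝓝 1)) (𝓝 1))
    (hcen : limitKernel (map φ) e ≤ Subgroup.center (SpecialLinearGroup ι K))
    {π : G →* SpecialLinearGroup ι k}
    (hconj : ∀ g a, g * e a * g⁻¹ = e (π g * a * (π g)⁻¹))
    {l : Ultrafilter G} (hl : (l : Filter G) ≤ 𝓝 1) (a b i j : ι) :
    ∃ x, Tendsto (fun g => φ (conjSingle (π g) a b i j)) l (𝓝 x) := by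
  obtain rfl | hab := eq_or_ne a b
  · have : Nontrivial ι := Fintype.one_lt_card_iff_nontrivial.1 (by omega)
    obtain ⟨c, hc⟩ := exists_ne a
    choose x hx using fun m => exists_tendsto_conjSingle_of_ne he hcen hconj hl hc.symm i m
    choose y hy using fun m => exists_tendsto_conjSingle_of_ne he hcen hconj hl hc m j
    refine ⟨∑ m, x m * y m, (tendsto_finsetSum _ fun m _ => (hx m).mul (hy m)).congr fun g => ?_⟩
    simp only [← map_mul, ← map_sum]
    rw [← Matrix.mul_apply, conjSingle_mul, single_mul_single_same, mul_one, conjSingle]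
  · exact exists_tendsto_conjSingle_of_ne he hcen hconj hl hab i j

omit [Group G] [TopologicalSpace G] [IsTopologicalGroup G] [T2Space G] in
theorem exists_tendsto_map_of_conjSingle {φ : k →+* K} {l : Ultrafilter G}
    {u : G → SpecialLinearGroup ι k}
    (h : ∀ a b i j, ∃ x, Tendsto (fun g => φ (conjSingle (u g) a b i j)) l (𝓝 x)) :
    ∃ x : SpecialLinearGroup ι K, Tendsto (fun g => map φ (u g)) l (𝓝 x) := by
  have hentry (i a : ι) : ∃ x, Tendsto (fun g => φ (u g i a)) l (𝓝 x) := by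
    choose x hx using fun b j => h a b i j
    have hD : Tendsto (fun g => φ (u g i a) • φ.mapMatrix (↑(u g)⁻¹ : Matrix ι ι k)) l
        (𝓝 (Matrix.of x)) := by
      refine tendsto_pi_nhds.2 fun b => tendsto_pi_nhds.2 fun j => (hx b j).congr fun g => ?_
      simp only [conjSingle_apply, map_mul]
      rfl
    have hdet : Tendsto (fun g => φ (u g i a) ^ Fintype.card ι) l (𝓝 (Matrix.of x).det) := by
      refine ((Continuous.matrix_det continuous_id).continuousAt.tendsto.comp hD).congr fun g => ?_
      simp only [Function.comp_apply, id, det_smul, ← RingHom.map_det, det_coe, map_one, mul_one]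
    have : Nonempty ι := ⟨i⟩
    have hcard : Fintype.card ι ≠ 0 := Fintype.card_ne_zero
    refine Ultrafilter.exists_tendsto_of_norm_le (C := max 1 (‖(Matrix.of x).det‖ + 1)) ?_
    filter_upwards [hdet.norm.eventually_lt_const (lt_add_one _)] with g hg
    rw [norm_pow] at hg
    rcases le_total ‖φ (u g i a)‖ 1 with h1 | h1
    · exact h1.trans (le_max_left _ _)
    · exact (le_self_pow₀ h1 hcard).trans (hg.le.trans (le_max_right _ _))
  choose x hx using hentry
  have hM : Tendsto (fun g => (map φ (u g) : Matrix ι ι K)) l (𝓝 (Matrix.of x)) :=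
    tendsto_pi_nhds.2 fun i => tendsto_pi_nhds.2 fun j => hx i j
  exact (exists_tendsto_of_coe hM).imp fun _ => And.right

omit [ProperSpace K] in
theorem commute_transvection_of_commutator_mem_center [CharZero K] {x : SpecialLinearGroup ι K}
    {a b : ι} (hab : a ≠ b)
    (h : x * transvection hab 1 * x⁻¹ * (transvection hab 1)⁻¹ ∈
      Subgroup.center (SpecialLinearGroup ι K)) : Commute (x : Matrix ι ι K) (single a b 1) := by
  have : Nonempty ι := ⟨a⟩
  obtain ⟨r, -, hr⟩ := mem_center_iff.1 h
  have hx : (↑x⁻¹ : Matrix ι ι K) * (x : Matrix ι ι K) = 1 := by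
    rw [← coe_mul, inv_mul_cancel, coe_one]
  have h1 : 1 + conjSingle x a b = scalar ι r * (1 + single a b 1) := by
    have h2 := coe_conj_transvection x hab (1 : K)
    rw [one_smul] at h2
    rw [← h2, hr, ← transvection_coe hab, ← coe_mul, inv_mul_cancel_right]
  have htr : (conjSingle x a b).trace = 0 := by
    rw [conjSingle, Matrix.trace_mul_comm, ← Matrix.mul_assoc, hx, Matrix.one_mul,
      trace_single_eq_of_ne _ _ _ hab]
  have hr1 : r = 1 := by
    have h3 := congrArg Matrix.trace h1
    rw [scalar_apply, ← smul_eq_diagonal_mul, trace_add, htr, trace_smul, trace_add,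
      trace_single_eq_of_ne _ _ _ hab] at h3
    have h4 : (Fintype.card ι : K) ≠ 0 := by exact_mod_cast Fintype.card_ne_zero
    simpa [h4] using h3.symm
  rw [hr1, map_one, one_mul, add_left_cancel_iff] at h1
  rw [commute_iff_eq]
  nth_rw 2 [← h1]
  rw [conjSingle, Matrix.mul_assoc, hx, Matrix.mul_one]

theorem exists_tendsto_map [CharZero K] (hι : 3 ≤ Fintype.card ι) {φ : k →+* K}
    (hφ : DenseRange φ) (hroot : ∀ ζ : K, ζ ^ Fintype.card ι = 1 → ∃ z, φ z = ζ)
    {e : SpecialLinearGroup ι k →* G} (he_inj : Function.Injective e)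
    (he : Tendsto e (comap (map φ) (𝓝 1)) (𝓝 1)) {π : G →* SpecialLinearGroup ι k}
    (hconj : ∀ g a, g * e a * g⁻¹ = e (π g * a * (π g)⁻¹))
    {l : Ultrafilter G} (hl : (l : Filter G) ≤ 𝓝 1) :
    ∃ z : SpecialLinearGroup ι k, Tendsto (fun g => map φ (π g)) l (𝓝 (map φ z)) := by
  have hcen := limitKernel_le_center hι hφ he_inj he
  obtain ⟨x, hx⟩ := exists_tendsto_map_of_conjSingle
    (exists_tendsto_conjSingle hι he hcen hconj hl)
  have hcomm : Pairwise fun a b => Commute (single a b (1 : K)) (x : Matrix ι ι K) := by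
    intro a b hab
    refine (commute_transvection_of_commutator_mem_center hab (hcen ?_)).symm
    have hφt : map φ (transvection hab (1 : k)) = transvection hab (1 : K) :=
      map_transvection_one φ hab
    refine mem_limitKernel_of_tendsto (F := (l : Filter G))
      (u := fun g => π g * transvection hab 1 * (π g)⁻¹ * (transvection hab 1)⁻¹) ?_ ?_
    · simpa only [map_mul, map_inv, hφt] using
        ((hx.mul_const (transvection hab 1)).mul hx.inv).mul_const (transvection hab 1)⁻¹
    · have hid : Tendsto (fun g : G => g) l (𝓝 1) := hl
      have h1 := ((hid.mul_const (e (transvection hab 1))).mul hid.inv).mul_const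
        (e (transvection hab 1))⁻¹
      simp only [one_mul, inv_one, mul_one, mul_inv_cancel] at h1
      refine h1.congr fun g => ?_
      rw [hconj, map_mul e _ (transvection hab 1)⁻¹, map_inv e]
  obtain ⟨ζ, hζ⟩ := mem_range_scalar_of_commute_single hcomm
  have hζ1 : ζ ^ Fintype.card ι = 1 := by
    have h1 := congrArg Matrix.det hζ
    simpa using h1
  obtain ⟨z, rfl⟩ := hroot ζ hζ1
  have hz : (scalar ι z).det = 1 := by
    rw [← map_pow, map_eq_one_iff φ φ.injective] at hζ1
    simpa using hζ1
  obtain ⟨y, hy⟩ : ∃ y : SpecialLinearGroup ι k, (y : Matrix ι ι k) = scalar ι z := ⟨⟨_, hz⟩, rfl⟩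
  have hyx : map φ y = x := by
    refine Subtype.ext ?_
    rw [← hζ, map_apply_coe, hy]
    ext a b
    simp [diagonal_apply, apply_ite φ]
  exact ⟨y, hyx ▸ hx⟩

end Main
end Matrix.SpecialLinearGroup

theorem PadicInt.sq_eq_one_of_pow_succ_eq_one {p : ℕ} [Fact p.Prime] {x : ℤ_[p]}
    (h : x ^ (p + 1) = 1) : x ^ 2 = 1 := by
  have hsq : toZMod (x ^ 2) = 1 := by
    have h1 := congrArg (toZMod (p := p)) h
    rw [map_pow, pow_succ, ZMod.pow_card, map_one] at h1
    rw [map_pow, sq, h1]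
  have hgeom : (∑ i ∈ Finset.range (p + 1), (x ^ 2) ^ i) ≠ 0 := by
    intro h0
    have h1 := congrArg (toZMod (p := p)) h0
    simp only [map_sum, map_pow (toZMod (p := p)) (x ^ 2), hsq] at h1
    simp at h1
  have h2 := mul_geom_sum (x ^ 2) (p + 1)
  rw [← pow_mul, mul_comm 2, pow_mul, h, one_pow, sub_self] at h2
  exact sub_eq_zero.1 ((mul_eq_zero.1 h2).resolve_right hgeom)

theorem Padic.eq_one_or_neg_one_of_pow_succ_eq_one {p : ℕ} [Fact p.Prime] {x : ℚ_[p]}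
    (h : x ^ (p + 1) = 1) : x = 1 ∨ x = -1 := by
  have hn : ‖x‖ ≤ 1 := by
    refine (pow_eq_one_iff_of_nonneg (norm_nonneg x) p.succ_ne_zero).1 ?_ |>.le
    rw [← norm_pow, h, norm_one]
  obtain ⟨y, rfl⟩ : ∃ y : ℤ_[p], (y : ℚ_[p]) = x := ⟨⟨x, hn⟩, rfl⟩
  have hy : y ^ (p + 1) = 1 := PadicInt.ext (by rw [PadicInt.coe_pow, h, PadicInt.coe_one])
  rw [← sq_eq_one_iff, ← PadicInt.coe_pow, PadicInt.sq_eq_one_of_pow_succ_eq_one hy,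
    PadicInt.coe_one]

namespace QPadic
variable (p : ℕ) (hp : p.Prime) [Fact p.Prime]

/-- The embedding of the rationals with the `p`-adic topology into the `p`-adic numbers. -/
noncomputable def toPadic : QPadic p hp →+* ℚ_[p] := Rat.castHom ℚ_[p]

theorem isInducing_toPadic : IsInducing (toPadic p hp) := ⟨rfl⟩

theorem denseRange_toPadic : DenseRange (toPadic p hp) := Padic.denseRange_ratCast p

theorem exists_toPadic_eq_of_pow_succ_eq_one {x : ℚ_[p]} (h : x ^ (p + 1) = 1) :
    ∃ z, toPadic p hp z = x := by
  obtain rfl | rfl := Padic.eq_one_or_neg_one_of_pow_succ_eq_one h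
  · exact ⟨1, map_one _⟩
  · exact ⟨-1, by simp⟩

theorem isInducing_map_toPadic (ι : Type*) [Fintype ι] [DecidableEq ι] :
    IsInducing (Matrix.SpecialLinearGroup.map (n := ι) (toPadic p hp)) :=
  (isInducing_toPadic p hp).specialLinearGroup_map

end QPadic

instance QPadic.isTopologicalGroup_specialLinearGroup (p : ℕ) (hp : p.Prime) (ι : Type*) [Fintype ι]
    [DecidableEq ι] : IsTopologicalGroup (Matrix.SpecialLinearGroup ι (QPadic p hp)) :=
  haveI : Fact p.Prime := ⟨hp⟩
  (QPadic.isInducing_map_toPadic p hp ι).topologicalGroup _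

theorem MonoidHom.mulSingle_injective {I : Type*} [DecidableEq I] (S : I → Type*)
    [∀ i, Group (S i)] (i : I) : Function.Injective (mulSingle S i) :=
  Pi.mulSingle_injective i

theorem MonoidHom.conj_mulSingle {I : Type*} [DecidableEq I] (S : I → Type*) [∀ i, Group (S i)]
    (i : I) (g : ∀ i, S i) (a : S i) :
    g * mulSingle S i a * g⁻¹ =
      mulSingle S i (Pi.evalMonoidHom S i g * a * (Pi.evalMonoidHom S i g)⁻¹) := by
  funext j
  obtain rfl | hj := eq_or_ne j i
  · simp
  · simp [hj]

/-- The topological product `G = ∏_{p prime} SL(p+1, (ℚ, τ_p))` is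
minimal, where `(ℚ, τ_p)` is the field of rationals with the `p`-adic topology. -/
theorem prod_sl_padic_minimal :
    IsMinimal (∀ p : {q : ℕ // q.Prime},
      Matrix.SpecialLinearGroup (Fin (p.1 + 1)) (QPadic p.1 p.2)) := by
  classical
  intro σ hσ hT2
  refine IsTopologicalGroup.ext σ.toIsTopologicalGroup inferInstance (le_antisymm ?_ ?_)
  swap
  · exact nhds_mono hσ
  rw [le_iff_ultrafilter]
  intro l hl
  have key (p : {q : ℕ // q.Prime}) :
      ∃ z : Matrix.SpecialLinearGroup (Fin (p.1 + 1)) (QPadic p.1 p.2),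
        Tendsto (fun g : ∀ p : {q : ℕ // q.Prime},
          Matrix.SpecialLinearGroup (Fin (p.1 + 1)) (QPadic p.1 p.2) => g p) l (𝓝 z) := by
    have : Fact p.1.Prime := ⟨p.2⟩
    have hind := QPadic.isInducing_map_toPadic p.1 p.2 (Fin (p.1 + 1))
    have he : Tendsto
        (MonoidHom.mulSingle (fun p : {q : ℕ // q.Prime} =>
          Matrix.SpecialLinearGroup (Fin (p.1 + 1)) (QPadic p.1 p.2)) p)
        (comap (Matrix.SpecialLinearGroup.map (QPadic.toPadic p.1 p.2)) (𝓝 1))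
        (@nhds _ σ.toTopologicalSpace 1) := by
      have h1 := hind.nhds_eq_comap 1
      rw [map_one] at h1
      rw [← h1]
      refine Tendsto.mono_right ?_ (nhds_mono hσ)
      exact (continuous_mulSingle p).tendsto' 1 1 (Pi.mulSingle_one p)
    have h := @Matrix.SpecialLinearGroup.exists_tendsto_map (Fin (p.1 + 1)) (QPadic p.1 p.2)
      ℚ_[p.1] _ _ _ _ _ _ σ.toTopologicalSpace σ.toIsTopologicalGroup hT2 _ _
      (by simpa using p.2.two_le)
      (QPadic.toPadic p.1 p.2) (QPadic.denseRange_toPadic p.1 p.2)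
      (fun ζ hζ => QPadic.exists_toPadic_eq_of_pow_succ_eq_one p.1 p.2 (by simpa using hζ))
      _ (MonoidHom.mulSingle_injective _ p) he _ (MonoidHom.conj_mulSingle _ p) l hl
    exact h.imp fun z hz => hind.tendsto_nhds_iff.2 hz
  choose z hz using key
  have hlz : (l : Filter _) ≤ 𝓝 z := tendsto_pi_nhds.2 hz
  have hz1 : z = 1 :=
    @tendsto_nhds_unique _ _ σ.toTopologicalSpace hT2 id l z 1 inferInstance
      (hlz.trans (nhds_mono hσ)) hl
  rwa [hz1] at hlz
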